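/- arXiv:1303.0017 — 5 statements merged into one kernel-verified Lean document; each statement's English description precedes it below -/
import Mathlib

section
/- Let d ∈ ℕ, R > 0, C ≥ 0, c > 0 and M, M_n ≥ 0 be real numbers. Let b, b_n : ℝ^d → ℝ^d be functions satisfying: (i) ⟨u − v, b(u) − b(v)⟩ ≤ C|u − v|² for all u, v ∈ ℝ^d with |u|, |v| ≤ R; (ii) |b(u)| ≤ c(M + |u|) and |b_n(u)| ≤ c(M_n + |u|) for all u ∈ ℝ^d. Then for all x, x_n, x_κ ∈ ℝ^d with |x|, |x_n|, |x_κ| ≤ R, setting e := x − x_n, one has ⟨e, b(x) − b_n(x_κ)⟩ ≤ (2C + 1)|e|² + (2C + 1)|x_n − x_κ|² + (1/2)|b(x_κ) − b_n(x_κ)|² + c · |x_n − x_κ| · (|x| + |x_κ| + M + M_n). -/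
open scoped RealInnerProductSpace

/-- Pointwise drift estimate: if `b` satisfies a one-sided Lipschitz condition with constant
`C` on the ball of radius `R` and `b`, `b_n` have linear growth, then for
`x, x_n, x_κ` in the ball of radius `R` and `e = x − x_n`,
`⟨e, b(x) − b_n(x_κ)⟩ ≤ (2C+1)|e|² + (2C+1)|x_n − x_κ|² + ½|b(x_κ) − b_n(x_κ)|²
  + c|x_n − x_κ|(|x| + |x_κ| + M + M_n)`. -/
theorem stmt3 (d : ℕ) (R C c M Mn : ℝ) (hR : 0 < R) (hC : 0 ≤ C) (hc : 0 < c)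
    (hM : 0 ≤ M) (hMn : 0 ≤ Mn)
    (b bn : EuclideanSpace ℝ (Fin d) → EuclideanSpace ℝ (Fin d))
    (hmono : ∀ u v : EuclideanSpace ℝ (Fin d), ‖u‖ ≤ R → ‖v‖ ≤ R →
      ⟪u - v, b u - b v⟫ ≤ C * ‖u - v‖ ^ 2)
    (hb : ∀ u : EuclideanSpace ℝ (Fin d), ‖b u‖ ≤ c * (M + ‖u‖))
    (hbn : ∀ u : EuclideanSpace ℝ (Fin d), ‖bn u‖ ≤ c * (Mn + ‖u‖)) :
    ∀ x xn xκ : EuclideanSpace ℝ (Fin d), ‖x‖ ≤ R → ‖xn‖ ≤ R → ‖xκ‖ ≤ R →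
      ⟪x - xn, b x - bn xκ⟫
        ≤ (2 * C + 1) * ‖x - xn‖ ^ 2 + (2 * C + 1) * ‖xn - xκ‖ ^ 2
          + (1 / 2) * ‖b xκ - bn xκ‖ ^ 2
          + c * ‖xn - xκ‖ * (‖x‖ + ‖xκ‖ + M + Mn) := by
  intro x xn xκ hx hxn hxκ
  have h1 := hmono x xκ hx hxκ
  have h2 : ⟪x - xκ, b xκ - bn xκ⟫ ≤ ‖x - xκ‖ * ‖b xκ - bn xκ‖ := real_inner_le_norm _ _
  have h3 : ⟪xκ - xn, b x - bn xκ⟫ ≤ ‖xκ - xn‖ * ‖b x - bn xκ‖ := real_inner_le_norm _ _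
  rw [norm_sub_rev xκ xn] at h3
  have h4 : ‖b x - bn xκ‖ ≤ c * (‖x‖ + ‖xκ‖ + M + Mn) := by
    have := norm_sub_le (b x) (bn xκ)
    linarith [hb x, hbn xκ]
  have h5 := mul_le_mul_of_nonneg_left h4 (norm_nonneg (xn - xκ))
  have h6 : ‖x - xκ‖ ^ 2 ≤ 2 * (‖x - xn‖ ^ 2 + ‖xn - xκ‖ ^ 2) := by
    have ht : ‖x - xκ‖ ≤ ‖x - xn‖ + ‖xn - xκ‖ := norm_sub_le_norm_sub_add_norm_sub x xn xκ
    have := pow_le_pow_left₀ (norm_nonneg (x - xκ)) ht 2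
    linarith [sq_nonneg (‖x - xn‖ - ‖xn - xκ‖)]
  have h7 := mul_le_mul_of_nonneg_left h6 hC
  have key : ⟪x - xn, b x - bn xκ⟫ = ⟪x - xκ, b x - b xκ⟫ + ⟪x - xκ, b xκ - bn xκ⟫
      + ⟪xκ - xn, b x - bn xκ⟫ := by
    rw [← inner_add_right, sub_add_sub_cancel, ← inner_add_left, sub_add_sub_cancel]
  rw [key]
  linarith [sq_nonneg (‖x - xκ‖ - ‖b xκ - bn xκ‖)]
end

section
/- Let d, k ∈ ℕ and let C > 0, l₁ > 0, l₂ > 0 be real numbers. Let β : ℝ^{d·k} × ℝ^d → ℝ^d satisfy, for all y, y' ∈ ℝ^{d·k} and u, u' ∈ ℝ^d: (i) ⟨u − u', β(y, u) − β(y, u')⟩ ≤ C|u − u'|²; (ii) |β(y, u) − β(y', u)|² ≤ C(1 + |y|^{l₁} + |y'|^{l₁})|y − y'|²; (iii) |β(y, u) − β(y, u')|² ≤ C(1 + |u|^{l₂} + |u'|^{l₂})|u − u'|². Then for all x, x_n, x_κ ∈ ℝ^d and y, y_n ∈ ℝ^{d·k}, setting e := x − x_n, one has ⟨e, β(y, x)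 − β(y_n, x_κ)⟩ ≤ (C + 1)|e|² + (C/2)(1 + |x_n|^{l₂} + |x_κ|^{l₂})|x_n − x_κ|² + (C/2)(1 + |y|^{l₁} + |y_n|^{l₁})|y − y_n|². -/
open scoped RealInnerProductSpace

/-- Key pointwise drift bound in the rate-one-half proof: if `β` satisfies a one-sided
Lipschitz condition in the non-delay argument, a polynomial Lipschitz condition with exponent
`l₁` in the delay argument and a polynomial Lipschitz condition with exponent `l₂` in the
non-delay argument (assumptions C-4 and C-5), then with `e = x − x_n`,
`⟨e, β(y,x) − β(y_n,x_κ)⟩ ≤ (C+1)|e|² + (C/2)(1+|x_n|^{l₂}+|x_κ|^{l₂})|x_n − x_κ|²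
  + (C/2)(1+|y|^{l₁}+|y_n|^{l₁})|y − y_n|²`. -/
theorem stmt6 (d k : ℕ) (C l₁ l₂ : ℝ) (hC : 0 < C) (hl₁ : 0 < l₁) (hl₂ : 0 < l₂)
    (β : EuclideanSpace ℝ (Fin (d * k)) → EuclideanSpace ℝ (Fin d) → EuclideanSpace ℝ (Fin d))
    (h₁ : ∀ (y : EuclideanSpace ℝ (Fin (d * k))) (u u' : EuclideanSpace ℝ (Fin d)),
      ⟪u - u', β y u - β y u'⟫ ≤ C * ‖u - u'‖ ^ 2)
    (h₂ : ∀ (y y' : EuclideanSpace ℝ (Fin (d * k))) (u : EuclideanSpace ℝ (Fin d)),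
      ‖β y u - β y' u‖ ^ 2 ≤ C * (1 + ‖y‖ ^ l₁ + ‖y'‖ ^ l₁) * ‖y - y'‖ ^ 2)
    (h₃ : ∀ (y : EuclideanSpace ℝ (Fin (d * k))) (u u' : EuclideanSpace ℝ (Fin d)),
      ‖β y u - β y u'‖ ^ 2 ≤ C * (1 + ‖u‖ ^ l₂ + ‖u'‖ ^ l₂) * ‖u - u'‖ ^ 2) :
    ∀ (x xn xκ : EuclideanSpace ℝ (Fin d)) (y yn : EuclideanSpace ℝ (Fin (d * k))),
      ⟪x - xn, β y x - β yn xκ⟫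
        ≤ (C + 1) * ‖x - xn‖ ^ 2
          + C / 2 * (1 + ‖xn‖ ^ l₂ + ‖xκ‖ ^ l₂) * ‖xn - xκ‖ ^ 2
          + C / 2 * (1 + ‖y‖ ^ l₁ + ‖yn‖ ^ l₁) * ‖y - yn‖ ^ 2 := by
  intro x xn xκ y yn
  have key : ∀ a b : EuclideanSpace ℝ (Fin d), ⟪a, b⟫ ≤ ‖a‖ ^ 2 / 2 + ‖b‖ ^ 2 / 2 := by
    intro a b
    have h := real_inner_le_norm a b
    nlinarith [sq_nonneg (‖a‖ - ‖b‖)]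
  have hs : β y x - β yn xκ
      = (β y x - β y xn) + (β y xn - β yn xn) + (β yn xn - β yn xκ) := by abel
  rw [hs, inner_add_right, inner_add_right]
  have a1 := h₁ y x xn
  have a2 := h₂ y yn xn
  have a3 := h₃ yn xn xκ
  have b2 := key (x - xn) (β y xn - β yn xn)
  have b3 := key (x - xn) (β yn xn - β yn xκ)
  linarith
end

section
/- Let (Ω, F, P) be a probability space, N ∈ ℕ, and let U, V : Ω → ℝ^N be random vectors. Let l > 0, p ≥ 1 and K ≥ 0 be real numbers with E[|U|^{l·p}] ≤ K, E[|V|^{l·p}] ≤ K and E[|U − V|^{2p}] < ∞. Then E[ (1 + |U|^l + |V|^l)^{p/2} · |U − V|^p ] ≤ 3^{(p−1)/2} · √(1 + 2K) · √(E[|U − V|^{2p}]). -/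
open MeasureTheory

/-- Cauchy–Schwarz estimate with a polynomially growing weight: if `E[|U|^{lp}] ≤ K`,
`E[|V|^{lp}] ≤ K` and `E[|U − V|^{2p}] < ∞`, then
`E[(1 + |U|^l + |V|^l)^{p/2} |U − V|^p] ≤ 3^{(p−1)/2} √(1 + 2K) √(E[|U − V|^{2p}])`. -/
theorem stmt8 {Ω : Type*} [MeasurableSpace Ω] (P : Measure Ω) [IsProbabilityMeasure P]
    (N : ℕ) (U V : Ω → EuclideanSpace ℝ (Fin N)) (hU : Measurable U) (hV : Measurable V)
    (l p K : ℝ) (hl : 0 < l) (hp : 1 ≤ p) (hK : 0 ≤ K)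
    (hUmom : ∫⁻ ω, ENNReal.ofReal (‖U ω‖ ^ (l * p)) ∂P ≤ ENNReal.ofReal K)
    (hVmom : ∫⁻ ω, ENNReal.ofReal (‖V ω‖ ^ (l * p)) ∂P ≤ ENNReal.ofReal K)
    (hUV : ∫⁻ ω, ENNReal.ofReal (‖U ω - V ω‖ ^ (2 * p)) ∂P < ⊤) :
    ∫⁻ ω, ENNReal.ofReal ((1 + ‖U ω‖ ^ l + ‖V ω‖ ^ l) ^ (p / 2) * ‖U ω - V ω‖ ^ p) ∂P
      ≤ ENNReal.ofReal (3 ^ ((p - 1) / 2) * Real.sqrt (1 + 2 * K)) *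
          (∫⁻ ω, ENNReal.ofReal (‖U ω - V ω‖ ^ (2 * p)) ∂P) ^ (1 / 2 : ℝ) := by
  have hne : ∀ ω, 0 ≤ 1 + ‖U ω‖ ^ l + ‖V ω‖ ^ l := fun ω => by positivity
  have key : ∀ ω, (1 + ‖U ω‖ ^ l + ‖V ω‖ ^ l) ^ p
      ≤ 3 ^ (p - 1) * (1 + ‖U ω‖ ^ (l * p) + ‖V ω‖ ^ (l * p)) := by
    intro ω
    have h := Real.rpow_sum_le_const_mul_sum_rpow_of_nonneg (s := Finset.univ)
      (f := ![1, ‖U ω‖ ^ l, ‖V ω‖ ^ l]) hp (by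
        intro i _
        fin_cases i <;> simp <;> positivity)
    simp only [Fin.sum_univ_three, Finset.card_univ, Fintype.card_fin] at h
    simpa [Real.rpow_mul] using h
  have hW : ∫⁻ ω, ENNReal.ofReal ((1 + ‖U ω‖ ^ l + ‖V ω‖ ^ l) ^ p) ∂P
      ≤ ENNReal.ofReal (3 ^ (p - 1) * (1 + 2 * K)) := by
    calc _ ≤ ∫⁻ ω, ENNReal.ofReal (3 ^ (p - 1)) * (1 + ENNReal.ofReal (‖U ω‖ ^ (l * p))
              + ENNReal.ofReal (‖V ω‖ ^ (l * p))) ∂P := by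
          refine lintegral_mono fun ω => ?_
          refine (ENNReal.ofReal_le_ofReal (key ω)).trans (le_of_eq ?_)
          rw [ENNReal.ofReal_mul (by positivity), ENNReal.ofReal_add (by positivity) (by positivity),
            ENNReal.ofReal_add (by positivity) (by positivity), ENNReal.ofReal_one]
      _ = ENNReal.ofReal (3 ^ (p - 1)) * (1 + ∫⁻ ω, ENNReal.ofReal (‖U ω‖ ^ (l * p)) ∂P
              + ∫⁻ ω, ENNReal.ofReal (‖V ω‖ ^ (l * p)) ∂P) := by
          rw [lintegral_const_mul _ (by fun_prop), lintegral_add_left (by fun_prop),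
            lintegral_add_left (by fun_prop)]
          simp
      _ ≤ ENNReal.ofReal (3 ^ (p - 1)) * (1 + ENNReal.ofReal K + ENNReal.ofReal K) := by gcongr
      _ = _ := by
          rw [ENNReal.ofReal_mul (by positivity), ← ENNReal.ofReal_one,
            ← ENNReal.ofReal_add (by positivity) (by positivity),
            ← ENNReal.ofReal_add (by positivity) (by positivity)]
          congr 2
          ring
  have hCS := ENNReal.lintegral_mul_le_Lp_mul_Lq P Real.HolderConjugate.two_two
    (f := fun ω => ENNReal.ofReal ((1 + ‖U ω‖ ^ l + ‖V ω‖ ^ l) ^ (p / 2)))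
    (g := fun ω => ENNReal.ofReal (‖U ω - V ω‖ ^ p)) (by fun_prop) (by fun_prop)
  have e1 : ∀ ω, ENNReal.ofReal ((1 + ‖U ω‖ ^ l + ‖V ω‖ ^ l) ^ (p / 2)) ^ (2 : ℝ)
      = ENNReal.ofReal ((1 + ‖U ω‖ ^ l + ‖V ω‖ ^ l) ^ p) := fun ω => by
    rw [ENNReal.ofReal_rpow_of_nonneg (by positivity) (by norm_num), ← Real.rpow_mul (hne ω)]
    congr 2
    ring
  have e2 : ∀ ω, ENNReal.ofReal (‖U ω - V ω‖ ^ p) ^ (2 : ℝ)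
      = ENNReal.ofReal (‖U ω - V ω‖ ^ (2 * p)) := fun ω => by
    rw [ENNReal.ofReal_rpow_of_nonneg (by positivity) (by norm_num),
      ← Real.rpow_mul (norm_nonneg _)]
    congr 2
    ring
  simp only [e1, e2, Pi.mul_apply] at hCS
  have e3 : ∀ ω, ENNReal.ofReal ((1 + ‖U ω‖ ^ l + ‖V ω‖ ^ l) ^ (p / 2) * ‖U ω - V ω‖ ^ p)
      = ENNReal.ofReal ((1 + ‖U ω‖ ^ l + ‖V ω‖ ^ l) ^ (p / 2))
        * ENNReal.ofReal (‖U ω - V ω‖ ^ p) := fun ω => ENNReal.ofReal_mul (by positivity)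
  simp only [e3]
  refine hCS.trans ?_
  gcongr
  refine (ENNReal.rpow_le_rpow hW (by norm_num : (0 : ℝ) ≤ 1 / 2)).trans (le_of_eq ?_)
  rw [ENNReal.ofReal_rpow_of_nonneg (by positivity) (by norm_num),
    Real.mul_rpow (by positivity) (by positivity), ← Real.rpow_mul (by norm_num),
    Real.sqrt_eq_rpow]
  congr 3
  ring
end

section
/- Let (Ω, F, P) be a probability space, d, k ∈ ℕ, a < b real numbers, and let (K_j)_{j∈ℕ} be nonnegative real numbers. Let β : ℝ^{d·k} × ℝ^d → ℝ^d satisfy: for every m ∈ ℕ and all y ∈ ℝ^{d·k}, x, z ∈ ℝ^d with |y| ≤ m, |x| ≤ m, |z| ≤ m, one has ⟨x − z, β(y, x) − β(y, z)⟩ ≤ K_m |x − z|². Let Y : [a,b] × Ω → ℝ^{d·k} be a jointly measurable process with continuous sample paths, and set S(ω) := sup_{t∈[a,b]} |Y(t,ω)|. For an integer R ≥ 1 define C_R := K_R · 1_{{S ≤ R}} + Σ_{j=R}^{∞} K_{j+1} · 1_{{j < S ≤ j+1}}. Then C_R is a random variable, P(C_R > K_R) ≤ P(S > R), and for every ω ∈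 Ω, every t ∈ [a,b], and all x, z ∈ ℝ^d with |x| ≤ R and |z| ≤ R, one has ⟨x − z, β(Y(t,ω), x) − β(Y(t,ω), z)⟩ ≤ C_R(ω) |x − z|². -/
open MeasureTheory
open scoped RealInnerProductSpace

/-- The random local one-sided Lipschitz constant
`C_R = K_R 1_{{S ≤ R}} + Σ_{j=R}^∞ K_{j+1} 1_{{j < S ≤ j+1}}`, where `S` is the running
supremum of the delayed process `Y` on `[a,b]` and `β` satisfies the local one-sided
Lipschitz condition C-2 with constant `K_m` on the ball of radius `m`: `C_R` is measurable,
`P(C_R > K_R) ≤ P(S > R)`, and `⟨x − z, β(Y(t,ω),x) − β(Y(t,ω),z)⟩ ≤ C_R(ω)|x − z|²` for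
all `t ∈ [a,b]` and `|x|, |z| ≤ R`. -/
theorem stmt9 {Ω : Type*} [MeasurableSpace Ω] (P : Measure Ω) [IsProbabilityMeasure P]
    (d k : ℕ) (a b : ℝ) (hab : a < b) (K : ℕ → ℝ) (hKnonneg : ∀ j, 0 ≤ K j)
    (β : EuclideanSpace ℝ (Fin (d * k)) → EuclideanSpace ℝ (Fin d) → EuclideanSpace ℝ (Fin d))
    (hβ : ∀ (m : ℕ) (y : EuclideanSpace ℝ (Fin (d * k))) (x z : EuclideanSpace ℝ (Fin d)),
      ‖y‖ ≤ m → ‖x‖ ≤ m → ‖z‖ ≤ m →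
        ⟪x - z, β y x - β y z⟫ ≤ K m * ‖x - z‖ ^ 2)
    (Y : ℝ → Ω → EuclideanSpace ℝ (Fin (d * k)))
    (hYmeas : Measurable (Function.uncurry Y))
    (hYcont : ∀ ω, ContinuousOn (fun t => Y t ω) (Set.Icc a b))
    (S : Ω → ℝ) (hS : ∀ ω, S ω = ⨆ t : Set.Icc a b, ‖Y (t : ℝ) ω‖)
    (R : ℕ) (hR : 1 ≤ R)
    (CR : Ω → ℝ)
    (hCR : ∀ ω, CR ω
      = K R * Set.indicator {ω' | S ω' ≤ (R : ℝ)} (fun _ => (1 : ℝ)) ω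
        + ∑' j : ℕ, K (R + j + 1) *
            Set.indicator {ω' | ((R : ℝ) + j < S ω') ∧ S ω' ≤ (R : ℝ) + j + 1}
              (fun _ => (1 : ℝ)) ω) :
    Measurable CR
    ∧ P {ω | K R < CR ω} ≤ P {ω | (R : ℝ) < S ω}
    ∧ ∀ ω, ∀ t ∈ Set.Icc a b, ∀ x z : EuclideanSpace ℝ (Fin d),
        ‖x‖ ≤ (R : ℝ) → ‖z‖ ≤ (R : ℝ) →
          ⟪x - z, β (Y t ω) x - β (Y t ω) z⟫ ≤ CR ω * ‖x - z‖ ^ 2 := by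
  have hne : Nonempty (Set.Icc a b) := ⟨⟨a, le_refl a, hab.le⟩⟩
  have hc : ∀ ω, Continuous (fun t : Set.Icc a b => ‖Y (t : ℝ) ω‖) := fun ω =>
    (continuousOn_iff_continuous_restrict.1 (hYcont ω)).norm
  have hbdd : ∀ ω, BddAbove (Set.range (fun t : Set.Icc a b => ‖Y (t : ℝ) ω‖)) := fun ω =>
    (isCompact_range (hc ω)).bddAbove
  have hle : ∀ ω c, S ω ≤ c ↔ ∀ t : Set.Icc a b, ‖Y (t : ℝ) ω‖ ≤ c := fun ω c => by
    rw [hS ω]; exact ciSup_le_iff (hbdd ω)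
  have hSm : Measurable S := by
    refine measurable_of_Iic fun c => ?_
    have h : S ⁻¹' Set.Iic c = ⋂ n : ℕ,
        {ω | ‖Y (TopologicalSpace.denseSeq (Set.Icc a b) n : ℝ) ω‖ ≤ c} := by
      ext ω
      simp only [Set.mem_preimage, Set.mem_Iic, Set.mem_iInter, Set.mem_setOf_eq, hle]
      refine ⟨fun h n => h _, fun h t => ?_⟩
      exact (TopologicalSpace.denseRange_denseSeq (Set.Icc a b)).induction_on
        (p := fun t : Set.Icc a b => ‖Y (t : ℝ) ω‖ ≤ c) t
        (isClosed_le (hc ω) continuous_const) h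
    rw [h]
    refine MeasurableSet.iInter fun n => ?_
    exact measurableSet_le
      ((hYmeas.comp (measurable_const.prodMk measurable_id)).norm) measurable_const
  have hlow : ∀ ω, S ω ≤ R → CR ω = K R := fun ω h => by
    have h0 : ∀ j : ℕ, K (R + j + 1) *
            Set.indicator {ω' | ((R : ℝ) + j < S ω') ∧ S ω' ≤ (R : ℝ) + j + 1}
              (fun _ => (1 : ℝ)) ω = 0 := fun j => by
      rw [Set.indicator_of_notMem, mul_zero]
      rintro ⟨h1, -⟩
      have : (0 : ℝ) ≤ j := j.cast_nonneg
      linarith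
    rw [hCR ω, tsum_congr h0, Set.indicator_of_mem (by exact h)]
    simp
  have hform : ∀ ω, CR ω = K (max R ⌈S ω⌉₊) := fun ω => by
    by_cases h : S ω ≤ R
    · rw [hlow ω h, max_eq_left (Nat.ceil_le.2 h)]
    · push Not at h
      have hlt : R < ⌈S ω⌉₊ := Nat.lt_ceil.2 h
      obtain ⟨j, hj⟩ := Nat.exists_eq_add_of_lt hlt
      have key := (Nat.ceil_eq_iff (a := S ω) (n := R + j + 1) (by omega)).1 hj
      simp only [Nat.add_sub_cancel] at key
      push_cast at key
      rw [hCR ω, tsum_eq_single j, Set.indicator_of_notMem (by simpa using h),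
        Set.indicator_of_mem (by exact key), max_eq_right hlt.le, hj]
      · simp
      · intro i hi
        rw [Set.indicator_of_notMem, mul_zero]
        rintro ⟨h1, h2⟩
        apply hi
        have h3 : ((R + i + 1 : ℕ) : ℝ) = (R : ℝ) + i + 1 := by push_cast; ring
        have := (Nat.ceil_eq_iff (a := S ω) (n := R + i + 1) (by omega)).2
          ⟨by simpa using h1, by rw [h3]; exact h2⟩
        omega
  refine ⟨?_, ?_, ?_⟩
  · rw [funext hform]
    exact (measurable_from_top (f := fun n : ℕ => K (max R n))).comp
      (Nat.measurable_ceil.comp hSm)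
  · refine measure_mono fun ω h => ?_
    by_contra h'
    have h1 := hlow ω (not_lt.1 h')
    have h2 : K R < CR ω := h
    linarith
  · intro ω t ht x z hx hz
    rw [hform ω]
    have hRm : (R : ℝ) ≤ ((max R ⌈S ω⌉₊ : ℕ) : ℝ) := Nat.cast_le.2 (le_max_left _ _)
    have hSm' : S ω ≤ ((max R ⌈S ω⌉₊ : ℕ) : ℝ) :=
      (Nat.le_ceil _).trans (Nat.cast_le.2 (le_max_right _ _))
    exact hβ _ _ _ _ (((hle ω _).1 le_rfl ⟨t, ht⟩).trans hSm') (hx.trans hRm) (hz.trans hRm)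
end

section
/- Let (Ω, F, P) be a probability space, d, k ∈ ℕ, and let G > 0, l > 0 be real numbers. Let β : ℝ^{d·k} × ℝ^d → ℝ^d be continuous, satisfying |β(y, x)| ≤ G(1 + |y|^l + |x|) for all y ∈ ℝ^{d·k}, x ∈ ℝ^d, and such that for every R > 0 and every y ∈ ℝ^{d·k}, sup_{|x| ≤ R} |β(y', x) − β(y, x)| → 0 as y' → y. Let Y and Y_n (n ≥ 1) be ℝ^{d·k}-valued random vectors such that (i) Y_n → Y in probability as n → ∞, and (ii) for every s > 0 there exists K(s) < ∞ with E[|Y|^s] ≤ K(s) and sup_{n ≥ 1} E[|Y_n|^s] ≤ K(s). Then for every p > 0 and every R > 0, E[ sup_{|x| ≤ R} |β(Y_n, x) − β(Y, x)|^p ] → 0 as n → ∞. -/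
open MeasureTheory

lemma rpow_three_aux (a b c q : ℝ) (ha : 0 ≤ a) (hb : 0 ≤ b) (hc : 0 ≤ c) (hq : 0 < q) :
    (a + b + c) ^ q ≤ 3 ^ q * (a ^ q + b ^ q + c ^ q) := by
  have key : ∀ m : ℝ, 0 ≤ m → a ≤ m → b ≤ m → c ≤ m → (a + b + c) ^ q ≤ 3 ^ q * m ^ q := by
    intro m hm h1 h2 h3
    rw [← Real.mul_rpow (by norm_num) hm]
    exact Real.rpow_le_rpow (by positivity) (by linarith) hq.le
  have h3 : (0 : ℝ) ≤ 3 ^ q := by positivity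
  have haq : 0 ≤ a ^ q := by positivity
  have hbq : 0 ≤ b ^ q := by positivity
  have hcq : 0 ≤ c ^ q := by positivity
  rcases le_total a b with h | h
  · rcases le_total b c with h' | h'
    · exact (key c hc (h.trans h') h' le_rfl).trans (mul_le_mul_of_nonneg_left (by linarith) h3)
    · exact (key b hb h le_rfl h').trans (mul_le_mul_of_nonneg_left (by linarith) h3)
  · rcases le_total a c with h' | h'
    · exact (key c hc h' (h.trans h') le_rfl).trans (mul_le_mul_of_nonneg_left (by linarith) h3)
    · exact (key a ha le_rfl h h').trans (mul_le_mul_of_nonneg_left (by linarith) h3)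

lemma sup_cont_aux {E V W : Type*} [TopologicalSpace E] [NormedAddCommGroup V] [ProperSpace V]
    [NormedAddCommGroup W] (β : E → V → W)
    (hβ : Continuous fun yx : E × V => β yx.1 yx.2) (p R : ℝ) (hp : 0 < p) :
    Continuous fun z : E × E =>
      ⨆ x : Metric.closedBall (0 : V) R, ‖β z.1 x.1 - β z.2 x.1‖ ^ p := by
  have hc : IsCompact (Metric.closedBall (0 : V) R) := isCompact_closedBall _ _
  have h := hc.continuous_sSup (f := fun (z : E × E) (x : V) => ‖β z.1 x - β z.2 x‖ ^ p) (by
    refine Continuous.rpow_const ?_ (fun _ => Or.inr hp.le)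
    refine Continuous.norm (Continuous.sub ?_ ?_)
    · exact hβ.comp (by fun_prop : Continuous fun q : (E × E) × V => (q.1.1, q.2))
    · exact hβ.comp (by fun_prop : Continuous fun q : (E × E) × V => (q.1.2, q.2)))
  simpa only [sSup_image'] using h

/-- Truncation plus a uniform second moment bound. -/
lemma trunc_aux {Ω : Type*} [MeasurableSpace Ω] (P : Measure Ω) [IsProbabilityMeasure P]
    (f : ℕ → Ω → ENNReal) (hf : ∀ n, Measurable (f n))
    (hlim : ∀ᵐ ω ∂P, Filter.Tendsto (fun n => f n ω) Filter.atTop (nhds 0))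
    (K : ENNReal) (hK : K ≠ ⊤) (hb : ∀ n, ∫⁻ ω, f n ω ^ 2 ∂P ≤ K) :
    Filter.Tendsto (fun n => ∫⁻ ω, f n ω ∂P) Filter.atTop (nhds 0) := by
  rw [ENNReal.tendsto_nhds_zero]
  intro ε hε
  have hε2 : 0 < ε / 2 := ENNReal.half_pos hε.ne'
  have hM : ∃ M : ℕ, 0 < M ∧ K / M ≤ ε / 2 := by
    have h1 : Filter.Tendsto (fun M : ℕ => K / (M : ENNReal)) Filter.atTop (nhds 0) := by
      have := ENNReal.Tendsto.const_div (a := K) ENNReal.tendsto_nat_nhds_top (Or.inr hK)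
      simpa using this
    have h2 := (ENNReal.tendsto_nhds_zero.1 h1 _ hε2).and (Filter.eventually_gt_atTop 0)
    obtain ⟨M, h3, h4⟩ := h2.exists
    exact ⟨M, h4, h3⟩
  obtain ⟨M, hM0, hMK⟩ := hM
  have hM0' : (M : ENNReal) ≠ 0 := by exact_mod_cast hM0.ne'
  have hMt : (M : ENNReal) ≠ ⊤ := ENNReal.natCast_ne_top M
  have hmin : Filter.Tendsto (fun n => ∫⁻ ω, min (f n ω) M ∂P) Filter.atTop (nhds 0) := by
    have := tendsto_lintegral_of_dominated_convergence (μ := P)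
      (F := fun n ω => min (f n ω) (M : ENNReal)) (f := fun _ => 0) (fun _ => (M : ENNReal))
      (fun n => (hf n).min measurable_const)
      (fun n => Filter.Eventually.of_forall fun ω => min_le_right _ _)
      (by simp) (by
        filter_upwards [hlim] with ω hω
        simpa using hω.min (tendsto_const_nhds (x := (M : ENNReal))))
    simpa using this
  filter_upwards [ENNReal.tendsto_nhds_zero.1 hmin _ hε2] with n hn
  have hpt : ∀ a : ENNReal, a ≤ min a M + a ^ 2 * (M : ENNReal)⁻¹ := by
    intro a
    rcases le_total a M with h | h
    · rw [min_eq_left h]; exact le_self_add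
    · refine le_trans ?_ le_add_self
      calc a = a * (M * (M : ENNReal)⁻¹) := by rw [ENNReal.mul_inv_cancel hM0' hMt, mul_one]
        _ ≤ a * (a * (M : ENNReal)⁻¹) := by gcongr
        _ = _ := by ring
  calc ∫⁻ ω, f n ω ∂P ≤ ∫⁻ ω, (min (f n ω) M + f n ω ^ 2 * (M : ENNReal)⁻¹) ∂P :=
        lintegral_mono fun ω => hpt _
    _ = ∫⁻ ω, min (f n ω) M ∂P + (∫⁻ ω, f n ω ^ 2 ∂P) * (M : ENNReal)⁻¹ := by
        rw [lintegral_add_left ((hf n).min measurable_const),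
          lintegral_mul_const _ ((hf n).pow_const 2)]
    _ ≤ ε / 2 + ε / 2 := by
        refine add_le_add hn (le_trans ?_ hMK)
        rw [div_eq_mul_inv]
        gcongr
        exact hb n
    _ = ε := ENNReal.add_halves ε

/-- Verification of assumption A-3: if `β` is continuous with polynomial growth (C-1) and
continuous in the delay argument uniformly over `x` in balls (C-3), and if `Y_n → Y` in
probability with uniformly bounded moments of all orders, then for every `p > 0` and `R > 0`,
`E[sup_{|x| ≤ R}|β(Y_n, x) − β(Y, x)|^p] → 0` as `n → ∞`. -/
theorem stmt12 {Ω : Type*} [MeasurableSpace Ω] (P : Measure Ω) [IsProbabilityMeasure P]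
    (d k : ℕ) (G l : ℝ) (hG : 0 < G) (hl : 0 < l)
    (β : EuclideanSpace ℝ (Fin (d * k)) → EuclideanSpace ℝ (Fin d) → EuclideanSpace ℝ (Fin d))
    (hβcont : Continuous fun yx : EuclideanSpace ℝ (Fin (d * k)) × EuclideanSpace ℝ (Fin d) =>
      β yx.1 yx.2)
    (hβgrowth : ∀ (y : EuclideanSpace ℝ (Fin (d * k))) (x : EuclideanSpace ℝ (Fin d)),
      ‖β y x‖ ≤ G * (1 + ‖y‖ ^ l + ‖x‖))
    (hβunif : ∀ R > (0 : ℝ), ∀ y : EuclideanSpace ℝ (Fin (d * k)),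
      Filter.Tendsto
        (fun y' => ⨆ x : Metric.closedBall (0 : EuclideanSpace ℝ (Fin d)) R,
          ‖β y' x.1 - β y x.1‖)
        (nhds y) (nhds 0))
    (Y : Ω → EuclideanSpace ℝ (Fin (d * k))) (Yn : ℕ → Ω → EuclideanSpace ℝ (Fin (d * k)))
    (hY : Measurable Y) (hYn : ∀ n, Measurable (Yn n))
    (hconv : TendstoInMeasure P Yn Filter.atTop Y)
    (hmom : ∀ s > (0 : ℝ), ∃ K : ℝ,
      (∫⁻ ω, ENNReal.ofReal (‖Y ω‖ ^ s) ∂P ≤ ENNReal.ofReal K) ∧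
        ∀ n, ∫⁻ ω, ENNReal.ofReal (‖Yn n ω‖ ^ s) ∂P ≤ ENNReal.ofReal K) :
    ∀ p > (0 : ℝ), ∀ R > (0 : ℝ),
      Filter.Tendsto
        (fun n => ∫⁻ ω, ENNReal.ofReal
          (⨆ x : Metric.closedBall (0 : EuclideanSpace ℝ (Fin d)) R,
            ‖β (Yn n ω) x.1 - β (Y ω) x.1‖ ^ p) ∂P)
        Filter.atTop (nhds 0) := by
  intro p hp R hR
  set F : EuclideanSpace ℝ (Fin (d * k)) × EuclideanSpace ℝ (Fin (d * k)) → ℝ := fun z =>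
    ⨆ x : Metric.closedBall (0 : EuclideanSpace ℝ (Fin d)) R, ‖β z.1 x.1 - β z.2 x.1‖ ^ p with hF
  have hFc : Continuous F := sup_cont_aux β hβcont p R hp
  have hF0 : ∀ z, 0 ≤ F z := fun z => Real.iSup_nonneg fun x => by positivity
  have hFd : ∀ y, F (y, y) = 0 := by
    intro y
    simp [hF, Real.zero_rpow hp.ne']
  have hne : Nonempty (Metric.closedBall (0 : EuclideanSpace ℝ (Fin d)) R) :=
    ⟨⟨0, by simp [hR.le]⟩⟩
  have hq : 0 < p * 2 := by positivity
  have hs : 0 < l * (p * 2) := by positivity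
  set A : ℝ := 2 * G * (1 + R) with hA
  have hA0 : 0 ≤ A := by positivity
  have hFb : ∀ y' y, F (y', y) ^ 2 ≤ 3 ^ (p * 2) * (A ^ (p * 2) +
      G ^ (p * 2) * ‖y'‖ ^ (l * (p * 2)) + G ^ (p * 2) * ‖y‖ ^ (l * (p * 2))) := by
    intro y' y
    have h1 : F (y', y) ≤ (A + G * ‖y'‖ ^ l + G * ‖y‖ ^ l) ^ p := by
      refine ciSup_le fun x => ?_
      refine Real.rpow_le_rpow (norm_nonneg _) ?_ hp.le
      have hx : ‖x.1‖ ≤ R := mem_closedBall_zero_iff.1 x.2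
      have e1 := hβgrowth y' x.1
      have e2 := hβgrowth y x.1
      have e3 := norm_sub_le (β y' x.1) (β y x.1)
      have e4 : G * ‖x.1‖ ≤ G * R := mul_le_mul_of_nonneg_left hx hG.le
      simp only [hA]
      linarith
    have h2 : F (y', y) ^ 2 ≤ (A + G * ‖y'‖ ^ l + G * ‖y‖ ^ l) ^ (p * 2) := by
      rw [Real.rpow_mul (by positivity)]
      have := pow_le_pow_left₀ (hF0 _) h1 2
      exact_mod_cast this
    refine h2.trans ((rpow_three_aux _ _ _ _ hA0 (by positivity) (by positivity) hq).trans_eq ?_)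
    rw [Real.mul_rpow hG.le (by positivity), Real.mul_rpow hG.le (by positivity),
      ← Real.rpow_mul (norm_nonneg _), ← Real.rpow_mul (norm_nonneg _)]
  obtain ⟨K, hKY, hKn⟩ := hmom _ hs
  set c : ENNReal := ENNReal.ofReal (3 ^ (p * 2))
  set a : ENNReal := ENNReal.ofReal (A ^ (p * 2))
  set g : ENNReal := ENNReal.ofReal (G ^ (p * 2))
  have hmeas : ∀ n, Measurable fun ω => ENNReal.ofReal (F (Yn n ω, Y ω)) := fun n =>
    (hFc.measurable.comp ((hYn n).prodMk hY)).ennreal_ofReal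
  have hbound : ∀ n, ∫⁻ ω, ENNReal.ofReal (F (Yn n ω, Y ω)) ^ 2 ∂P ≤
      c * (a + g * ENNReal.ofReal K + g * ENNReal.ofReal K) := by
    intro n
    have m1 : Measurable fun ω => ENNReal.ofReal (‖Yn n ω‖ ^ (l * (p * 2))) :=
      ((hYn n).norm.pow_const _).ennreal_ofReal
    have m2 : Measurable fun ω => ENNReal.ofReal (‖Y ω‖ ^ (l * (p * 2))) :=
      (hY.norm.pow_const _).ennreal_ofReal
    calc ∫⁻ ω, ENNReal.ofReal (F (Yn n ω, Y ω)) ^ 2 ∂P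
        ≤ ∫⁻ ω, c * (a + g * ENNReal.ofReal (‖Yn n ω‖ ^ (l * (p * 2))) +
            g * ENNReal.ofReal (‖Y ω‖ ^ (l * (p * 2)))) ∂P := by
          refine lintegral_mono fun ω => ?_
          dsimp only
          rw [← ENNReal.ofReal_pow (hF0 _), ← ENNReal.ofReal_mul (by positivity),
            ← ENNReal.ofReal_mul (by positivity), ← ENNReal.ofReal_add (by positivity)
            (by positivity), ← ENNReal.ofReal_add (by positivity) (by positivity),
            ← ENNReal.ofReal_mul (by positivity)]
          exact ENNReal.ofReal_le_ofReal (hFb _ _)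
      _ = c * (a + g * ∫⁻ ω, ENNReal.ofReal (‖Yn n ω‖ ^ (l * (p * 2))) ∂P +
            g * ∫⁻ ω, ENNReal.ofReal (‖Y ω‖ ^ (l * (p * 2))) ∂P) := by
          rw [lintegral_const_mul _ (by fun_prop), lintegral_add_left (by fun_prop),
            lintegral_add_left measurable_const, lintegral_const_mul _ m1,
            lintegral_const_mul _ m2]
          simp
      _ ≤ _ := by
          gcongr
          exact hKn n
  refine Filter.tendsto_of_subseq_tendsto fun ns hns => ?_
  have hsub : TendstoInMeasure P (fun n => Yn (ns n)) Filter.atTop Y := fun ε hε =>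
    (hconv ε hε).comp hns
  obtain ⟨ms, -, hae⟩ := hsub.exists_seq_tendsto_ae
  refine ⟨ms, ?_⟩
  refine trunc_aux P (fun n ω => ENNReal.ofReal (F (Yn (ns (ms n)) ω, Y ω)))
    (fun n => hmeas _) ?_ (c * (a + g * ENNReal.ofReal K + g * ENNReal.ofReal K))
    (by finiteness) (fun n => hbound _)
  filter_upwards [hae] with ω hω
  have h1 : Filter.Tendsto (fun n => F (Yn (ns (ms n)) ω, Y ω)) Filter.atTop
      (nhds (F (Y ω, Y ω))) :=
    (hFc.tendsto _).comp (hω.prodMk_nhds tendsto_const_nhds)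
  rw [hFd] at h1
  simpa using ENNReal.tendsto_ofReal h1
end
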